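/- arXiv:2306.15360 — 2 statements merged into one kernel-verified Lean document; each statement's English description precedes it below -/
import Mathlib

section
/- Let p₁, p₂, p₃, p₄ ∈ ℂ[ζ₁,ζ₂,ζ₃] be polynomials each of which is invariant under the action of the complex orthogonal group O(2,ℂ) := {B ∈ GL₂(ℂ) : ᵗB·B = I₂} on the first two variables, i.e. p_j(B·(ζ₁,ζ₂), ζ₃) = p_j(ζ₁,ζ₂,ζ₃) for every B ∈ O(2,ℂ) and j = 1,2,3,4. Then ζ₁²·p₁ + ζ₂²·p₂ + ζ₁ζ₂·p₃ + p₄ = 0 if and only if p₁ = p₂, p₃ = 0, and (ζ₁²+ζ₂²)·p₁ + p₄ = 0. -/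
noncomputable section

/-- The action of a `2 × 2` complex matrix `B` on `ℂ[ζ₁,ζ₂,ζ₃]`: substitute for
`(ζ₁, ζ₂)` the two components of `B·(ζ₁, ζ₂)`, leaving `ζ₃` unchanged. -/
def actO2 (B : Matrix (Fin 2) (Fin 2) ℂ) (p : MvPolynomial (Fin 3) ℂ) :
    MvPolynomial (Fin 3) ℂ :=
  MvPolynomial.bind₁
    (fun i => if i = 0 then
        MvPolynomial.C (B 0 0) * MvPolynomial.X 0 + MvPolynomial.C (B 0 1) * MvPolynomial.X 1
      else if i = 1 then
        MvPolynomial.C (B 1 0) * MvPolynomial.X 0 + MvPolynomial.C (B 1 1) * MvPolynomial.X 1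
      else MvPolynomial.X 2) p

theorem actO2_add (B : Matrix (Fin 2) (Fin 2) ℂ) (p q : MvPolynomial (Fin 3) ℂ) :
    actO2 B (p + q) = actO2 B p + actO2 B q := map_add _ _ _

theorem actO2_mul (B : Matrix (Fin 2) (Fin 2) ℂ) (p q : MvPolynomial (Fin 3) ℂ) :
    actO2 B (p * q) = actO2 B p * actO2 B q := map_mul _ _ _

theorem actO2_pow (B : Matrix (Fin 2) (Fin 2) ℂ) (p : MvPolynomial (Fin 3) ℂ) (n : ℕ) :
    actO2 B (p ^ n) = actO2 B p ^ n := map_pow _ _ _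

theorem actO2_zero (B : Matrix (Fin 2) (Fin 2) ℂ) : actO2 B 0 = 0 := map_zero _

theorem actO2_X_zero (B : Matrix (Fin 2) (Fin 2) ℂ) :
    actO2 B (MvPolynomial.X 0) =
      MvPolynomial.C (B 0 0) * MvPolynomial.X 0 + MvPolynomial.C (B 0 1) * MvPolynomial.X 1 := by
  simp [actO2]

theorem actO2_X_one (B : Matrix (Fin 2) (Fin 2) ℂ) :
    actO2 B (MvPolynomial.X 1) =
      MvPolynomial.C (B 1 0) * MvPolynomial.X 0 + MvPolynomial.C (B 1 1) * MvPolynomial.X 1 := by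
  simp [actO2]

theorem X_zero_sq_sub_X_one_sq_ne_zero :
    (MvPolynomial.X 0 ^ 2 - MvPolynomial.X 1 ^ 2 : MvPolynomial (Fin 3) ℂ) ≠ 0 := fun h => by
  simpa using congrArg (MvPolynomial.eval (Pi.single 0 1)) h

theorem invariant_polynomials
    (p1 p2 p3 p4 : MvPolynomial (Fin 3) ℂ)
    (h1 : ∀ B : Matrix (Fin 2) (Fin 2) ℂ, B.transpose * B = 1 → actO2 B p1 = p1)
    (h2 : ∀ B : Matrix (Fin 2) (Fin 2) ℂ, B.transpose * B = 1 → actO2 B p2 = p2)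
    (h3 : ∀ B : Matrix (Fin 2) (Fin 2) ℂ, B.transpose * B = 1 → actO2 B p3 = p3)
    (h4 : ∀ B : Matrix (Fin 2) (Fin 2) ℂ, B.transpose * B = 1 → actO2 B p4 = p4) :
    MvPolynomial.X 0 ^ 2 * p1 + MvPolynomial.X 1 ^ 2 * p2
        + MvPolynomial.X 0 * MvPolynomial.X 1 * p3 + p4 = 0 ↔
      (p1 = p2 ∧ p3 = 0 ∧ (MvPolynomial.X 0 ^ 2 + MvPolynomial.X 1 ^ 2) * p1 + p4 = 0) := by
  constructor
  · intro h
    have hdiag : (!![-1, 0; 0, 1] : Matrix (Fin 2) (Fin 2) ℂ).transpose * !![-1, 0; 0, 1] = 1 := by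
      ext i j; fin_cases i <;> fin_cases j <;> simp [Matrix.mul_apply]
    have hswap : (!![0, 1; 1, 0] : Matrix (Fin 2) (Fin 2) ℂ).transpose * !![0, 1; 1, 0] = 1 := by
      ext i j; fin_cases i <;> fin_cases j <;> simp [Matrix.mul_apply]
    have hd := congrArg (actO2 !![-1, 0; 0, 1]) h
    have hs := congrArg (actO2 !![0, 1; 1, 0]) h
    simp only [actO2_add, actO2_mul, actO2_pow, actO2_zero, actO2_X_zero, actO2_X_one,
      h1 _ hdiag, h2 _ hdiag, h3 _ hdiag, h4 _ hdiag] at hd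
    simp only [actO2_add, actO2_mul, actO2_pow, actO2_zero, actO2_X_zero, actO2_X_one,
      h1 _ hswap, h2 _ hswap, h3 _ hswap, h4 _ hswap] at hs
    simp at hd hs
    have hp3 : p3 = 0 := by
      have : (2 * MvPolynomial.X 0 * MvPolynomial.X 1) * p3 = 0 := by linear_combination h - hd
      simpa [MvPolynomial.X_ne_zero] using this
    subst hp3
    have hp12 : p1 = p2 := by
      have : (MvPolynomial.X 0 ^ 2 - MvPolynomial.X 1 ^ 2) * (p1 - p2) = 0 := by
        linear_combination h - hs
      exact sub_eq_zero.mp ((mul_eq_zero.mp this).resolve_left X_zero_sq_sub_X_one_sq_ne_zero)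
    subst hp12
    exact ⟨rfl, rfl, by linear_combination h⟩
  · rintro ⟨rfl, rfl, h⟩
    linear_combination h

end
end

section
/- Let λ, ν ∈ ℂ, let m be a nonzero integer, and let a ∈ ℕ. Let Pol^a(ℂ³) ⊂ ℂ[ζ₁,ζ₂,ζ₃] be the space of homogeneous polynomials of degree a. For s ∈ ℝ let R(s) := [[cos s, −sin s],[sin s, cos s]], let ρ(s) := diag(R(s),1) ∈ GL₃(ℂ), and let π(s) act on ℂ[ζ₁,ζ₂,ζ₃] by (π(s)p)(ζ₁,ζ₂,ζ₃) := p(R(s)⁻¹(ζ₁,ζ₂), ζ₃). Let W := {T : ℂ³ → Pol^a(ℂ³) linear : T(ρ(s)v) = e^{ims}·π(s)(T(v)) for all s ∈ ℝ, v ∈ ℂ³, and e^{λt}·T = e^{(ν−a)t}·T for all t ∈ ℝ}. Then W ≠ {0} if and only if ν − λ = a and a ≥ |m| − 1. -/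
noncomputable section

/-- The rotation `ρ(s) = diag(R(s), 1)` acting on `ℂ³`. -/
def rho (s : ℝ) (v : Fin 3 → ℂ) : Fin 3 → ℂ :=
  ![(Real.cos s : ℂ) * v 0 - (Real.sin s : ℂ) * v 1,
    (Real.sin s : ℂ) * v 0 + (Real.cos s : ℂ) * v 1, v 2]

/-- The action `π(s)` on `ℂ[ζ₁,ζ₂,ζ₃]`: `(π(s)p)(ζ₁,ζ₂,ζ₃) = p(R(s)⁻¹(ζ₁,ζ₂), ζ₃)`,
i.e. the substitution `ζ₁ ↦ cos s·ζ₁ + sin s·ζ₂`, `ζ₂ ↦ -sin s·ζ₁ + cos s·ζ₂`,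
`ζ₃ ↦ ζ₃` (note `R(s)⁻¹ = R(-s)`). -/
def rotSub3 (s : ℝ) (p : MvPolynomial (Fin 3) ℂ) : MvPolynomial (Fin 3) ℂ :=
  MvPolynomial.bind₁ (fun i : Fin 3 =>
    if i = 0 then
      MvPolynomial.C ((Real.cos s : ℂ)) * MvPolynomial.X 0
        + MvPolynomial.C ((Real.sin s : ℂ)) * MvPolynomial.X 1
    else if i = 1 then
      MvPolynomial.C (-(Real.sin s : ℂ)) * MvPolynomial.X 0
        + MvPolynomial.C ((Real.cos s : ℂ)) * MvPolynomial.X 1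
    else MvPolynomial.X 2) p

/-- The space `W` of linear maps `T : ℂ³ → Pol^a(ℂ³)` satisfying
`T(ρ(s)v) = e^{ims}·π(s)(T(v))` and `e^{λt}·T = e^{(ν-a)t}·T`. -/
def W6 (lam ν : ℂ) (m : ℤ) (a : ℕ) :
    Set ((Fin 3 → ℂ) →ₗ[ℂ] MvPolynomial (Fin 3) ℂ) :=
  {T | (∀ v, (T v).IsHomogeneous a) ∧
    (∀ (s : ℝ) (v : Fin 3 → ℂ),
      T (rho s v) = Complex.exp (Complex.I * m * s) • rotSub3 s (T v)) ∧
    (∀ t : ℝ, Complex.exp (lam * t) • T = Complex.exp ((ν - a) * t) • T)}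

/-- Two one-parameter exponentials that agree on the real line have the same exponent. -/
theorem eq_of_forall_exp_mul_ofReal_eq {b c : ℂ}
    (h : ∀ t : ℝ, Complex.exp (b * t) = Complex.exp (c * t)) : b = c := by
  have key : ∀ z : ℂ, HasDerivAt (fun t : ℝ => Complex.exp (z * t)) z 0 := by
    intro z
    have h1 : HasDerivAt (fun w : ℂ => Complex.exp (z * w)) z ((0 : ℝ) : ℂ) := by
      simpa using ((hasDerivAt_id (((0 : ℝ) : ℂ))).const_mul z).cexp
    exact h1.comp_ofReal
  have hb := key b
  rw [funext h] at hb
  exact hb.unique (key c)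

/-- Rescaling the variables acts diagonally on the coefficients of a polynomial. -/
theorem MvPolynomial.coeff_bind₁_C_mul_X {σ R : Type*} [Fintype σ] [CommSemiring R] (c : σ → R)
    (p : MvPolynomial σ R) (d : σ →₀ ℕ) :
    (MvPolynomial.bind₁ (fun i => MvPolynomial.C (c i) * MvPolynomial.X i) p).coeff d
      = (∏ i, c i ^ d i) * p.coeff d := by
  classical
  induction p using MvPolynomial.induction_on' with
  | monomial e r =>
    have h : MvPolynomial.bind₁ (fun i => MvPolynomial.C (c i) * MvPolynomial.X i)
        (MvPolynomial.monomial e r) = MvPolynomial.monomial e ((∏ i, c i ^ e i) * r) := by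
      rw [MvPolynomial.bind₁_monomial, MvPolynomial.monomial_eq, Finsupp.prod,
        Finset.prod_subset (Finset.subset_univ e.support), Finset.prod_subset
        (Finset.subset_univ e.support)]
      · simp only [mul_pow, Finset.prod_mul_distrib, map_mul, map_prod, map_pow]
        ring
      all_goals
        intro i _ hi
        simp [Finsupp.notMem_support_iff.mp hi]
    rw [h, MvPolynomial.coeff_monomial, MvPolynomial.coeff_monomial]
    split_ifs with hed
    · rw [hed]
    · simp
  | add p q hp hq => simp only [map_add, MvPolynomial.coeff_add, hp, hq, mul_add]

/-- The linear change of variables taking `ζ₁ + iζ₂` and `ζ₁ - iζ₂` to the first two variables. -/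
def diagonalize : MvPolynomial (Fin 3) ℂ →ₐ[ℂ] MvPolynomial (Fin 3) ℂ :=
  MvPolynomial.bind₁ ![
    MvPolynomial.C (1 / 2) * (MvPolynomial.X 0 + MvPolynomial.X 1),
    MvPolynomial.C (-Complex.I / 2) * (MvPolynomial.X 0 - MvPolynomial.X 1),
    MvPolynomial.X 2]

theorem diagonalize_injective : Function.Injective diagonalize := by
  let ψ : MvPolynomial (Fin 3) ℂ →ₐ[ℂ] MvPolynomial (Fin 3) ℂ :=
    MvPolynomial.bind₁ ![
      MvPolynomial.X 0 + MvPolynomial.C Complex.I * MvPolynomial.X 1,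
      MvPolynomial.X 0 - MvPolynomial.C Complex.I * MvPolynomial.X 1,
      MvPolynomial.X 2]
  have hψ : ψ.comp diagonalize = AlgHom.id ℂ _ := by
    have h2 : (MvPolynomial.C (1 / 2) : MvPolynomial (Fin 3) ℂ) * 2 = 1 := by
      rw [← map_ofNat MvPolynomial.C 2, ← map_mul]
      norm_num
    have hI : (MvPolynomial.C (-Complex.I / 2) : MvPolynomial (Fin 3) ℂ)
        * MvPolynomial.C Complex.I * 2 = 1 := by
      rw [← map_ofNat MvPolynomial.C 2, ← map_mul, ← map_mul, ← map_one MvPolynomial.C]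
      congr 1
      linear_combination -Complex.I_mul_I
    refine MvPolynomial.algHom_ext fun i => ?_
    fin_cases i
    · simp only [ψ, diagonalize, AlgHom.comp_apply, MvPolynomial.bind₁_X_right, map_mul, map_add,
        MvPolynomial.bind₁_C_right, AlgHom.id_apply, Fin.zero_eta, Matrix.cons_val]
      linear_combination MvPolynomial.X 0 * h2
    · simp only [ψ, diagonalize, AlgHom.comp_apply, MvPolynomial.bind₁_X_right, map_mul, map_sub,
        MvPolynomial.bind₁_C_right, AlgHom.id_apply, Fin.mk_one, Matrix.cons_val]
      linear_combination MvPolynomial.X 1 * hI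
    · simp [ψ, diagonalize]
  exact Function.LeftInverse.injective (g := ψ) fun p => DFunLike.congr_fun hψ p

theorem isHomogeneous_diagonalize {p : MvPolynomial (Fin 3) ℂ} {a : ℕ} (hp : p.IsHomogeneous a) :
    (diagonalize p).IsHomogeneous a := by
  have h := hp.aeval (n := 1) ![
    MvPolynomial.C (1 / 2) * (MvPolynomial.X 0 + MvPolynomial.X 1),
    MvPolynomial.C (-Complex.I / 2) * (MvPolynomial.X 0 - MvPolynomial.X 1),
    (MvPolynomial.X 2 : MvPolynomial (Fin 3) ℂ)] (by
      intro i
      fin_cases i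
      · exact ((MvPolynomial.isHomogeneous_X _ _).add (MvPolynomial.isHomogeneous_X _ _)).C_mul _
      · exact ((MvPolynomial.isHomogeneous_X _ _).sub (MvPolynomial.isHomogeneous_X _ _)).C_mul _
      · exact MvPolynomial.isHomogeneous_X _ _)
  rwa [one_mul] at h

theorem cexp_I_mul_ofReal (s : ℝ) :
    Complex.exp (Complex.I * s) = Real.cos s + Complex.I * Real.sin s := by
  rw [mul_comm, Complex.exp_mul_I, Complex.ofReal_cos, Complex.ofReal_sin, mul_comm Complex.I]

theorem cexp_neg_I_mul_ofReal (s : ℝ) :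
    Complex.exp (-Complex.I * s) = Real.cos s - Complex.I * Real.sin s := by
  have h := cexp_I_mul_ofReal (-s)
  rw [Real.cos_neg, Real.sin_neg] at h
  push_cast at h ⊢
  rw [neg_mul, ← mul_neg, h]
  ring

theorem diagonalize_rotSub3 (s : ℝ) (p : MvPolynomial (Fin 3) ℂ) :
    diagonalize (rotSub3 s p) = MvPolynomial.bind₁ (fun i =>
      MvPolynomial.C (![Complex.exp (-Complex.I * s), Complex.exp (Complex.I * s), 1] i)
        * MvPolynomial.X i) (diagonalize p) := by
  unfold rotSub3
  rw [← AlgHom.comp_apply, ← AlgHom.comp_apply]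
  refine DFunLike.congr_fun (F := _ →ₐ[ℂ] _) ?_ p
  have hC : (MvPolynomial.C (-Complex.I / 2) : MvPolynomial (Fin 3) ℂ)
      = -(MvPolynomial.C (1 / 2) * MvPolynomial.C Complex.I) := by
    rw [← map_mul, ← map_neg]
    congr 1
    ring
  have hI : (MvPolynomial.C Complex.I : MvPolynomial (Fin 3) ℂ) * MvPolynomial.C Complex.I
      = -1 := by
    rw [← map_mul, Complex.I_mul_I, map_neg, map_one]
  refine MvPolynomial.algHom_ext fun i => ?_
  fin_cases i
  · simp [diagonalize, cexp_I_mul_ofReal, cexp_neg_I_mul_ofReal, hC, -Complex.ofReal_cos,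
      -Complex.ofReal_sin, -neg_mul, -one_div]
    ring
  · simp [diagonalize, cexp_I_mul_ofReal, cexp_neg_I_mul_ofReal, hC, -Complex.ofReal_cos,
      -Complex.ofReal_sin, -neg_mul, -one_div]
    linear_combination (-MvPolynomial.C (1 / 2) * MvPolynomial.C (Real.sin s : ℂ) *
      (MvPolynomial.X 0 + MvPolynomial.X 1)) * hI
  · simp [diagonalize]

/-- The weights of the rotation action on polynomials of degree `a` are bounded by `a`. -/
theorem natAbs_le_of_rotSub3_eq {p : MvPolynomial (Fin 3) ℂ} {a : ℕ} {j : ℤ}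
    (hp : p.IsHomogeneous a) (hp0 : p ≠ 0)
    (h : ∀ s : ℝ, rotSub3 s p = Complex.exp (Complex.I * j * s) • p) : j.natAbs ≤ a := by
  have hq0 : diagonalize p ≠ 0 := (map_ne_zero_iff _ diagonalize_injective).mpr hp0
  obtain ⟨d, hd⟩ := MvPolynomial.ne_zero_iff.mp hq0
  have hdeg : d 0 + d 1 + d 2 = a := by
    have := isHomogeneous_diagonalize hp hd
    rwa [Pi.one_def, ← Finsupp.degree_eq_weight_one, Finsupp.degree_eq_sum, Fin.sum_univ_three]
      at this
  have hj : Complex.I * j = Complex.I * ((d 1 : ℂ) - d 0) := by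
    refine eq_of_forall_exp_mul_ofReal_eq fun s => ?_
    have h1 := congrArg (MvPolynomial.coeff d) (diagonalize_rotSub3 s p)
    rw [h s, MvPolynomial.coeff_bind₁_C_mul_X, map_smul, MvPolynomial.coeff_smul, smul_eq_mul]
      at h1
    rw [mul_right_cancel₀ hd h1]
    simp only [Fin.prod_univ_three, Matrix.cons_val, one_pow, mul_one, ← Complex.exp_nat_mul,
      ← Complex.exp_add]
    congr 1
    ring
  have hj' : j = (d 1 : ℤ) - d 0 := by
    exact_mod_cast mul_left_cancel₀ Complex.I_ne_zero hj
  omega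

/-- An equivariant map sends a weight vector of `ℂ³` to a weight vector. -/
theorem rotSub3_map_weight_vector {T : (Fin 3 → ℂ) →ₗ[ℂ] MvPolynomial (Fin 3) ℂ} {m : ℤ}
    (hT : ∀ (s : ℝ) (v : Fin 3 → ℂ),
      T (rho s v) = Complex.exp (Complex.I * m * s) • rotSub3 s (T v))
    {k : ℤ} {w : Fin 3 → ℂ} (hw : ∀ s : ℝ, rho s w = Complex.exp (Complex.I * k * s) • w)
    (s : ℝ) : rotSub3 s (T w) = Complex.exp (Complex.I * (k - m : ℤ) * s) • T w := by
  have h := hT s w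
  rw [hw, map_smul] at h
  have h2 := congrArg (fun q => Complex.exp (-(Complex.I * m * s)) • q) h
  simp only [smul_smul, ← Complex.exp_add] at h2
  rw [neg_add_cancel, Complex.exp_zero, one_smul] at h2
  rw [← h2]
  congr 2
  push_cast
  ring

theorem rho_weight_vector {k : ℤ} (hk : k = 1 ∨ k = -1) (s : ℝ) :
    rho s ![1, -Complex.I * k, 0] = Complex.exp (Complex.I * k * s) • ![1, -Complex.I * k, 0] := by
  rcases hk with rfl | rfl
  · have h : Complex.exp (Complex.I * (1 : ℤ) * s) = Real.cos s + Complex.I * Real.sin s := by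
      rw [← cexp_I_mul_ofReal]
      simp
    rw [h]
    ext i
    fin_cases i
    · simp [rho]
      ring
    · simp [rho]
      linear_combination Complex.sin s * Complex.I_mul_I
    · simp [rho]
  · have h : Complex.exp (Complex.I * (-1 : ℤ) * s) = Real.cos s - Complex.I * Real.sin s := by
      rw [← cexp_neg_I_mul_ofReal]
      simp
    rw [h]
    ext i
    fin_cases i
    · simp [rho]
      ring
    · simp [rho]
      linear_combination Complex.sin s * Complex.I_mul_I
    · simp [rho]

/-- A nonzero linear map on `ℂ³` is nonzero on some weight vector of the rotation action. -/
theorem exists_weight_vector_map_ne_zero {T : (Fin 3 → ℂ) →ₗ[ℂ] MvPolynomial (Fin 3) ℂ}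
    (hT : T ≠ 0) : ∃ (k : ℤ) (w : Fin 3 → ℂ), k.natAbs ≤ 1 ∧
      (∀ s : ℝ, rho s w = Complex.exp (Complex.I * k * s) • w) ∧ T w ≠ 0 := by
  by_contra! hcon
  have h0 : T ![0, 0, 1] = 0 := hcon 0 _ (by simp) fun s => by simp [rho]
  have h1 : T ![1, -Complex.I * (1 : ℤ), 0] = 0 :=
    hcon 1 _ (by simp) (rho_weight_vector (.inl rfl))
  have h2 : T ![1, -Complex.I * (-1 : ℤ), 0] = 0 :=
    hcon (-1) _ (by simp) (rho_weight_vector (.inr rfl))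
  refine hT (LinearMap.ext fun v => ?_)
  have hv : v = ((v 0 + Complex.I * v 1) / 2) • ![1, -Complex.I * (1 : ℤ), 0]
      + ((v 0 - Complex.I * v 1) / 2) • ![1, -Complex.I * (-1 : ℤ), 0]
      + v 2 • ![0, 0, 1] := by
    ext i
    fin_cases i
    · simp
      ring
    · simp
      linear_combination v 1 * Complex.I_mul_I
    · simp
  rw [hv, map_add, map_add, map_smul, map_smul, map_smul, h0, h1, h2]
  simp

/-- The equivariant map with values in the line spanned by `(ζ₁ + iεζ₂)ⁿ ζ₃ʳ`. -/
def equivariantMap (ε : ℂ) (n r : ℕ) : (Fin 3 → ℂ) →ₗ[ℂ] MvPolynomial (Fin 3) ℂ :=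
  (LinearMap.proj 0 + (ε * Complex.I) • LinearMap.proj 1 : (Fin 3 → ℂ) →ₗ[ℂ] ℂ).smulRight
    ((MvPolynomial.X 0 + MvPolynomial.C (ε * Complex.I) * MvPolynomial.X 1) ^ n
      * MvPolynomial.X 2 ^ r)

theorem equivariantMap_apply (ε : ℂ) (n r : ℕ) (v : Fin 3 → ℂ) :
    equivariantMap ε n r v = (v 0 + ε * Complex.I * v 1) •
      ((MvPolynomial.X 0 + MvPolynomial.C (ε * Complex.I) * MvPolynomial.X 1) ^ n
        * MvPolynomial.X 2 ^ r) := by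
  simp [equivariantMap]

theorem equivariantMap_ne_zero (ε : ℂ) (n r : ℕ) : equivariantMap ε n r ≠ 0 := by
  intro h
  have h1 := congrArg (MvPolynomial.eval ![1, 0, 1]) (DFunLike.congr_fun h ![1, 0, 0])
  simp [equivariantMap_apply] at h1

theorem isHomogeneous_equivariantMap (ε : ℂ) (n r : ℕ) (v : Fin 3 → ℂ) :
    (equivariantMap ε n r v).IsHomogeneous (n + r) := by
  rw [equivariantMap_apply, MvPolynomial.smul_eq_C_mul]
  have h1 : (MvPolynomial.X 0 + MvPolynomial.C (ε * Complex.I) * MvPolynomial.X 1 :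
      MvPolynomial (Fin 3) ℂ).IsHomogeneous 1 :=
    (MvPolynomial.isHomogeneous_X _ _).add ((MvPolynomial.isHomogeneous_X _ _).C_mul _)
  simpa using ((h1.pow n).mul ((MvPolynomial.isHomogeneous_X ℂ (2 : Fin 3)).pow r)).C_mul
    (v 0 + ε * Complex.I * v 1)

theorem equivariantMap_rho {ε : ℤ} (hε : ε = 1 ∨ ε = -1) (n r : ℕ) (s : ℝ) (v : Fin 3 → ℂ) :
    equivariantMap ε n r (rho s v) =
      Complex.exp (Complex.I * (ε * (n + 1) : ℤ) * s) • rotSub3 s (equivariantMap ε n r v) := by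
  have hee : (ε : ℂ) * ε = 1 := by
    rcases hε with rfl | rfl <;> simp
  have hexp : ∀ δ : ℤ, δ = 1 ∨ δ = -1 →
      Complex.exp (Complex.I * δ * s) = Real.cos s + δ * Complex.I * Real.sin s := by
    rintro δ (rfl | rfl)
    · have := cexp_I_mul_ofReal s
      simpa using this
    · have := cexp_neg_I_mul_ofReal s
      simpa [sub_eq_add_neg] using this
  have hv : (rho s v) 0 + ε * Complex.I * (rho s v) 1
      = Complex.exp (Complex.I * ε * s) * (v 0 + ε * Complex.I * v 1) := by
    rw [hexp ε hε]
    simp only [rho, Matrix.cons_val]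
    linear_combination (-Real.sin s * v 1 * ε * ε) * Complex.I_mul_I + Real.sin s * v 1 * hee
  have hz : rotSub3 s (MvPolynomial.X 0 + MvPolynomial.C (ε * Complex.I) * MvPolynomial.X 1)
      = MvPolynomial.C (Complex.exp (-(Complex.I * ε * s))) *
        (MvPolynomial.X 0 + MvPolynomial.C (ε * Complex.I) * MvPolynomial.X 1) := by
    have h1 : Complex.exp (-(Complex.I * ε * s))
        = Real.cos s - ε * Complex.I * Real.sin s := by
      have := hexp (-ε) (by omega)
      push_cast at this ⊢
      rw [show -(Complex.I * ε * s) = Complex.I * -ε * s by ring, this]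
      ring
    have h2 : (MvPolynomial.C (ε * Complex.I) : MvPolynomial (Fin 3) ℂ)
        * MvPolynomial.C (ε * Complex.I) = -1 := by
      rw [← map_mul, ← map_one MvPolynomial.C, ← map_neg]
      congr 1
      linear_combination ε * ε * Complex.I_mul_I - hee
    rw [h1, map_sub, map_mul MvPolynomial.C (ε * Complex.I)]
    simp only [rotSub3, map_add, map_mul (MvPolynomial.bind₁ _), MvPolynomial.bind₁_X_right,
      MvPolynomial.bind₁_C_right, if_true, one_ne_zero, if_false, map_neg]
    linear_combination (MvPolynomial.C (Real.sin s : ℂ) * MvPolynomial.X 1) * h2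
  have hpow : rotSub3 s ((MvPolynomial.X 0 + MvPolynomial.C (ε * Complex.I) * MvPolynomial.X 1) ^ n
        * MvPolynomial.X 2 ^ r) = MvPolynomial.C (Complex.exp (-(Complex.I * ε * s)) ^ n) *
      ((MvPolynomial.X 0 + MvPolynomial.C (ε * Complex.I) * MvPolynomial.X 1) ^ n
        * MvPolynomial.X 2 ^ r) := by
    have hX : rotSub3 s (MvPolynomial.X 2) = MvPolynomial.X 2 := by simp [rotSub3]
    unfold rotSub3 at hz hX ⊢
    rw [map_mul, map_pow, map_pow, hz, hX, mul_pow, map_pow, mul_assoc]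
  have hsmul : ∀ (c : ℂ) (q : MvPolynomial (Fin 3) ℂ), rotSub3 s (c • q) = c • rotSub3 s q :=
    fun c q => by unfold rotSub3; exact map_smul _ c q
  rw [equivariantMap_apply, equivariantMap_apply, hv, hsmul, hpow,
    ← MvPolynomial.smul_eq_C_mul (a := _ ^ n), smul_smul, smul_smul, ← Complex.exp_nat_mul]
  congr 1
  have hsum : Complex.exp (Complex.I * ε * s) = Complex.exp (Complex.I * (ε * (n + 1) : ℤ) * s)
      * Complex.exp (n * -(Complex.I * ε * s)) := by
    rw [← Complex.exp_add]
    congr 1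
    push_cast
    ring
  rw [hsum]
  ring

theorem hom_Lprime_nonzero_iff (lam ν : ℂ) (m : ℤ) (hm : m ≠ 0) (a : ℕ) :
    W6 lam ν m a ≠ {0} ↔ (ν - lam = (a : ℂ) ∧ m.natAbs - 1 ≤ a) := by
  have h0 : (0 : (Fin 3 → ℂ) →ₗ[ℂ] MvPolynomial (Fin 3) ℂ) ∈ W6 lam ν m a := by
    refine ⟨fun v => MvPolynomial.isHomogeneous_zero _ _ _, fun s v => ?_, fun t => ?_⟩
    · simp [rotSub3]
    · simp
  constructor
  · intro hW
    obtain ⟨T, ⟨hhom, heq, hA⟩, hT0⟩ : ∃ T ∈ W6 lam ν m a, T ≠ 0 := by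
      by_contra! hcon
      exact hW (Set.eq_singleton_iff_unique_mem.mpr ⟨h0, hcon⟩)
    constructor
    · have : lam = ν - a :=
        eq_of_forall_exp_mul_ofReal_eq fun t => smul_left_injective ℂ hT0 (hA t)
      rw [this, sub_sub_cancel]
    · obtain ⟨k, w, hk, hw, hTw⟩ := exists_weight_vector_map_ne_zero hT0
      have := natAbs_le_of_rotSub3_eq (hhom w) hTw (rotSub3_map_weight_vector heq hw)
      omega
  · rintro ⟨hν, hma⟩ hW
    obtain ⟨r, hr⟩ := Nat.exists_eq_add_of_le hma
    obtain ⟨ε, hε, hmε⟩ : ∃ ε : ℤ, (ε = 1 ∨ ε = -1) ∧ m = ε * ((m.natAbs - 1 : ℕ) + 1) := by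
      rcases lt_or_gt_of_ne hm with h | h
      · exact ⟨-1, .inr rfl, by omega⟩
      · exact ⟨1, .inl rfl, by omega⟩
    have hmem : equivariantMap ε (m.natAbs - 1) r ∈ W6 lam ν m a := by
      refine ⟨fun v => ?_, fun s v => ?_, fun t => ?_⟩
      · rw [hr]
        exact isHomogeneous_equivariantMap _ _ _ v
      · rw [equivariantMap_rho hε, ← hmε]
      · rw [← hν, sub_sub_cancel]
    rw [hW] at hmem
    exact equivariantMap_ne_zero _ _ _ hmem

end
end
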